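/- Let β > 0 and let b = {b_j : j ∈ ℤ} satisfy |b_j| ≤ C₀(1 + |j|)^β for all j ∈ ℤ and some C₀ > 0. Then there exists a constant C > 0 such that the interpolant f_b(x) = Σ_{j∈ℤ} b_j L_k(x − j) satisfies |f_b(x)| ≤ C(1 + |x|)^β for all x ∈ ℝ. -/

import Mathlib

open MeasureTheory Filter
open scoped ENNReal

noncomputable def S (α : ℝ) (k : ℕ) (ξ : ℝ) : ℝ :=
  ∑' j : ℤ, (((ξ - 2 * Real.pi * j) ^ 2 + α ^ 2) ^ k)⁻¹

noncomputable def Lhat (α : ℝ) (k : ℕ) (ξ : ℝ) : ℝ :=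
  (Real.sqrt (2 * Real.pi))⁻¹ * ((ξ ^ 2 + α ^ 2) ^ k)⁻¹ / S α k ξ

noncomputable def Lk (α : ℝ) (k : ℕ) (x : ℝ) : ℝ :=
  (((Real.sqrt (2 * Real.pi) : ℂ))⁻¹ *
    ∫ ξ : ℝ, (Lhat α k ξ : ℂ) * Complex.exp (Complex.I * x * ξ)).re

lemma summable_int_inv_one_add_sq : Summable fun j : ℤ => (1 + (j : ℝ) ^ 2)⁻¹ := by
  refine Summable.of_norm_bounded_eventually
    (Real.summable_one_div_int_pow.mpr (one_lt_two : 1 < 2)) ?_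
  filter_upwards [(Set.finite_singleton (0 : ℤ)).compl_mem_cofinite] with j hj
  have hj0 : (j : ℝ) ≠ 0 := by simpa using hj
  rw [Real.norm_of_nonneg (by positivity), one_div]
  gcongr
  linarith

lemma re_sq_add_le_norm_sq_add_sq {α : ℝ} {w : ℂ} (hw : |w.im| < α / 2) :
    w.re ^ 2 + α ^ 2 / 4 ≤ ‖w ^ 2 + (α : ℂ) ^ 2‖ := by
  obtain ⟨h1, h2⟩ := abs_lt.mp hw
  refine le_of_sq_le_sq ?_ (norm_nonneg _)
  have hfac : w ^ 2 + (α : ℂ) ^ 2 = (w + Complex.I * α) * (w - Complex.I * α) := by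
    linear_combination (α : ℂ) ^ 2 * Complex.I_sq
  have hp : w.re ^ 2 + α ^ 2 / 4 ≤ Complex.normSq (w + Complex.I * α) := by
    simp [Complex.normSq_apply]
    nlinarith
  have hm : w.re ^ 2 + α ^ 2 / 4 ≤ Complex.normSq (w - Complex.I * α) := by
    simp [Complex.normSq_apply]
    nlinarith
  rw [hfac, ← Complex.normSq_eq_norm_sq, Complex.normSq_mul, sq]
  exact mul_le_mul hp hm (by positivity) (Complex.normSq_nonneg _)

lemma exists_norm_inv_pow_le {α : ℝ} (hα : 0 < α) {k : ℕ} (hk : 1 ≤ k) (R : ℝ) :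
    ∃ K : ℝ, ∀ (j : ℤ) (z : ℂ), |z.re| < R → |z.im| < α / 2 →
      ‖(((z - 2 * Real.pi * j) ^ 2 + (α : ℂ) ^ 2) ^ k)⁻¹‖ ≤ K * (1 + (j : ℝ) ^ 2)⁻¹ := by
  set c : ℝ := α ^ 2 / 4 with hc
  have hc0 : 0 < c := by positivity
  refine ⟨(c ^ (k - 1))⁻¹ * (2 + (1 + 2 * R ^ 2) / c), fun j z hre him => ?_⟩
  set w : ℂ := z - 2 * Real.pi * j with hw
  have hwim : w.im = z.im := by simp [hw]
  have hwre : w.re = z.re - 2 * Real.pi * j := by simp [hw]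
  have hlow : w.re ^ 2 + c ≤ ‖w ^ 2 + (α : ℂ) ^ 2‖ :=
    re_sq_add_le_norm_sq_add_sq (by rwa [hwim])
  have hpow : c ^ (k - 1) * (w.re ^ 2 + c) ≤ ‖w ^ 2 + (α : ℂ) ^ 2‖ ^ k := by
    obtain ⟨m, rfl⟩ : ∃ m, k = m + 1 := ⟨k - 1, by omega⟩
    rw [pow_succ _ m, Nat.add_sub_cancel]
    have : c ≤ ‖w ^ 2 + (α : ℂ) ^ 2‖ := by nlinarith [sq_nonneg w.re]
    gcongr
  have hj : 1 + (j : ℝ) ^ 2 ≤ (2 + (1 + 2 * R ^ 2) / c) * (w.re ^ 2 + c) := by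
    have hz : z.re ^ 2 ≤ R ^ 2 := sq_le_sq' (by linarith [(abs_lt.mp hre).1])
      (by linarith [(abs_lt.mp hre).2])
    have h1 : (j : ℝ) ^ 2 ≤ (2 * Real.pi * j) ^ 2 := by
      have : (1 : ℝ) ≤ (2 * Real.pi) ^ 2 := by nlinarith [Real.pi_gt_three]
      nlinarith [sq_nonneg (j : ℝ)]
    have h2 : (2 * Real.pi * j) ^ 2 ≤ 2 * w.re ^ 2 + 2 * z.re ^ 2 := by
      rw [hwre]; nlinarith [sq_nonneg (2 * z.re - 2 * Real.pi * j)]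
    have h3 : (1 + 2 * R ^ 2) ≤ (1 + 2 * R ^ 2) / c * (w.re ^ 2 + c) := by
      rw [div_mul_eq_mul_div, le_div_iff₀ hc0]
      nlinarith [sq_nonneg w.re, mul_nonneg (by positivity : 0 ≤ 1 + 2 * R ^ 2) (sq_nonneg w.re)]
    nlinarith
  rw [norm_inv, norm_pow]
  calc (‖w ^ 2 + (α : ℂ) ^ 2‖ ^ k)⁻¹ ≤ (c ^ (k - 1) * (w.re ^ 2 + c))⁻¹ := by gcongr
    _ = (c ^ (k - 1))⁻¹ * (w.re ^ 2 + c)⁻¹ := mul_inv _ _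
    _ ≤ (c ^ (k - 1))⁻¹ * ((2 + (1 + 2 * R ^ 2) / c) * (1 + (j : ℝ) ^ 2)⁻¹) := by
        gcongr
        rw [← div_eq_mul_inv, le_div_iff₀ (by positivity), inv_mul_le_iff₀ (by positivity)]
        linarith
    _ = _ := by ring

lemma contDiff_S {α : ℝ} (hα : 0 < α) {k : ℕ} (hk : 1 ≤ k) (n : WithTop ℕ∞) :
    ContDiff ℝ n (S α k) := by
  set F : ℂ → ℂ := fun z => ∑' j : ℤ, (((z - 2 * Real.pi * j) ^ 2 + (α : ℂ) ^ 2) ^ k)⁻¹ with hF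
  have hSF : S α k = fun x : ℝ => (F x).re := by
    funext x
    have : F x = (S α k x : ℂ) := by
      simp [hF, S, Complex.ofReal_tsum]
    rw [this, Complex.ofReal_re]
  rw [hSF, contDiff_iff_contDiffAt]
  intro x
  apply ContDiffAt.real_of_complex
  set R : ℝ := |x| + 1
  obtain ⟨K, hK⟩ := exists_norm_inv_pow_le hα hk R
  set U : Set ℂ := {z | |z.re| < R} ∩ {z | |z.im| < α / 2} with hU
  have hUo : IsOpen U :=
    (isOpen_lt (by fun_prop) (by fun_prop)).inter (isOpen_lt (by fun_prop) (by fun_prop))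
  have hd : DifferentiableOn ℂ F U := by
    refine Complex.differentiableOn_tsum_of_summable_norm (summable_int_inv_one_add_sq.mul_left K)
      (fun j => ?_) hUo (fun j z hz => hK j z hz.1 hz.2)
    refine DifferentiableOn.inv (by fun_prop) fun z hz => pow_ne_zero _ ?_
    rw [← norm_pos_iff]
    refine lt_of_lt_of_le ?_ (re_sq_add_le_norm_sq_add_sq (by simpa using hz.2))
    positivity
  exact (hd.analyticAt (hUo.mem_nhds ⟨by simp [R], by simpa using by linarith⟩)).contDiffAt

lemma S_pos {α : ℝ} (hα : 0 < α) {k : ℕ} (hk : 1 ≤ k) (ξ : ℝ) : 0 < S α k ξ := by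
  obtain ⟨K, hK⟩ := exists_norm_inv_pow_le hα hk (|ξ| + 1)
  have hs : Summable fun j : ℤ => (((ξ - 2 * Real.pi * j) ^ 2 + α ^ 2) ^ k)⁻¹ := by
    refine Summable.of_norm_bounded (summable_int_inv_one_add_sq.mul_left K) fun j => ?_
    have := hK j ξ (by simp) (by simpa using by linarith)
    rw [← Complex.norm_real]
    simpa using this
  exact hs.tsum_pos (fun j => by positivity) 0 (by positivity)

lemma S_periodic (α : ℝ) (k : ℕ) : Function.Periodic (S α k) (2 * Real.pi) := by
  intro ξ
  unfold S
  rw [← (Equiv.addRight (1 : ℤ)).tsum_eq]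
  refine tsum_congr fun j => ?_
  simp only [Equiv.coe_addRight, Int.cast_add, Int.cast_one]
  ring_nf

/-- The derivatives of a smooth periodic function are bounded. -/
lemma Function.Periodic.exists_norm_iteratedDeriv_le {f : ℝ → ℝ} {T : ℝ}
    (hf : Function.Periodic f T) (hT : T ≠ 0) (n : ℕ) (hs : ContDiff ℝ n f) :
    ∃ M : ℝ, ∀ x, ‖iteratedDeriv n f x‖ ≤ M := by
  have hp : Function.Periodic (iteratedDeriv n f) T := fun x => by
    have h := congrFun (iteratedDeriv_comp_add_const n f T) x
    rw [← h, funext hf]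
  obtain ⟨M, hM⟩ := (hp.isBounded_of_continuous hT
    (hs.continuous_iteratedDeriv n le_rfl)).exists_norm_le
  exact ⟨M, fun x => hM _ ⟨x, rfl⟩⟩

lemma contDiff_pow_mul_inv_pow {α : ℝ} (hα : 0 < α) (a m : ℕ) (n : WithTop ℕ∞) :
    ContDiff ℝ n fun ξ : ℝ => ξ ^ a * ((ξ ^ 2 + α ^ 2) ^ m)⁻¹ := by
  refine ContDiff.mul (by fun_prop) (ContDiff.inv (by fun_prop) fun ξ => ?_)
  positivity

lemma integrable_inv_sq_add_sq {α : ℝ} (hα : 0 < α) :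
    Integrable fun ξ : ℝ => (ξ ^ 2 + α ^ 2)⁻¹ := by
  have h := (integrable_inv_one_add_sq.comp_div hα.ne').const_mul (α ^ 2)⁻¹
  refine h.congr (ae_of_all _ fun ξ => ?_)
  simp only
  field_simp
  ring

lemma integrable_pow_mul_inv_pow {α : ℝ} (hα : 0 < α) {a m : ℕ} (h : a + 2 ≤ 2 * m) :
    Integrable fun ξ : ℝ => ξ ^ a * ((ξ ^ 2 + α ^ 2) ^ m)⁻¹ := by
  obtain ⟨d, hd⟩ : ∃ d, 2 * m = a + 2 + d := ⟨2 * m - (a + 2), by omega⟩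
  refine ((integrable_inv_sq_add_sq hα).const_mul (α ^ d)⁻¹).mono'
    (contDiff_pow_mul_inv_pow hα a m 0).continuous.aestronglyMeasurable (ae_of_all _ fun ξ => ?_)
  set q : ℝ := ξ ^ 2 + α ^ 2 with hq
  have hq0 : 0 < q := by positivity
  have hα' : α ≤ √q := Real.le_sqrt_of_sq_le (by nlinarith [sq_nonneg ξ])
  have hξ : |ξ| ≤ √q := Real.abs_le_sqrt (by nlinarith)
  have hqm : q ^ m = √q ^ a * q * √q ^ d := by
    calc q ^ m = (√q ^ 2) ^ m := by rw [Real.sq_sqrt hq0.le]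
      _ = √q ^ a * √q ^ 2 * √q ^ d := by rw [← pow_mul, hd, pow_add, pow_add]
      _ = _ := by rw [Real.sq_sqrt hq0.le]
  rw [norm_mul, norm_pow, Real.norm_eq_abs, Real.norm_of_nonneg (by positivity),
    ← div_eq_mul_inv, div_le_iff₀ (by positivity)]
  calc |ξ| ^ a ≤ √q ^ a := by gcongr
    _ = (√q ^ d)⁻¹ * q⁻¹ * q ^ m := by
        have : 0 < √q := Real.sqrt_pos.mpr hq0
        rw [hqm]; field_simp
    _ ≤ (α ^ d)⁻¹ * q⁻¹ * q ^ m := by gcongr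

lemma integrable_iteratedDeriv_pow_mul_inv_pow {α : ℝ} (hα : 0 < α) (n : ℕ) :
    ∀ {a m : ℕ}, a + 2 ≤ 2 * m →
      Integrable (iteratedDeriv n fun ξ : ℝ => ξ ^ a * ((ξ ^ 2 + α ^ 2) ^ m)⁻¹) := by
  induction n with
  | zero => intro a m h; simpa using integrable_pow_mul_inv_pow hα h
  | succ n ih =>
    intro a m h
    have hderiv : (deriv fun ξ : ℝ => ξ ^ a * ((ξ ^ 2 + α ^ 2) ^ m)⁻¹) = fun ξ : ℝ =>
        (a : ℝ) * (ξ ^ (a - 1) * ((ξ ^ 2 + α ^ 2) ^ m)⁻¹) -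
          (2 * m : ℝ) * (ξ ^ (a + 1) * ((ξ ^ 2 + α ^ 2) ^ (m + 1))⁻¹) := by
      funext ξ
      have hq : ξ ^ 2 + α ^ 2 ≠ 0 := by positivity
      have h1 := (((hasDerivAt_pow 2 ξ).add_const (α ^ 2)).pow m).inv (pow_ne_zero m hq)
      have h2 := ((hasDerivAt_pow a ξ).mul h1).deriv
      refine h2.trans ?_
      obtain ⟨l, rfl⟩ : ∃ l, m = l + 1 := ⟨m - 1, by omega⟩
      simp
      field_simp
      ring
    have hsplit : iteratedDeriv n (fun ξ : ℝ =>
        (a : ℝ) * (ξ ^ (a - 1) * ((ξ ^ 2 + α ^ 2) ^ m)⁻¹) -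
          (2 * m : ℝ) * (ξ ^ (a + 1) * ((ξ ^ 2 + α ^ 2) ^ (m + 1))⁻¹)) = fun ξ =>
        (a : ℝ) * iteratedDeriv n (fun ξ : ℝ => ξ ^ (a - 1) * ((ξ ^ 2 + α ^ 2) ^ m)⁻¹) ξ -
          (2 * m : ℝ) *
            iteratedDeriv n (fun ξ : ℝ => ξ ^ (a + 1) * ((ξ ^ 2 + α ^ 2) ^ (m + 1))⁻¹) ξ := by
      funext ξ
      rw [iteratedDeriv_fun_sub
        (contDiff_const.mul (contDiff_pow_mul_inv_pow hα _ _ _)).contDiffAt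
        (contDiff_const.mul (contDiff_pow_mul_inv_pow hα _ _ _)).contDiffAt,
        iteratedDeriv_const_mul_field, iteratedDeriv_const_mul_field]
    rw [iteratedDeriv_succ', hderiv, hsplit]
    exact ((ih (by omega)).const_mul _).sub ((ih (by omega)).const_mul _)

lemma Lhat_eq (α : ℝ) (k : ℕ) : Lhat α k = fun ξ =>
    ((Real.sqrt (2 * Real.pi))⁻¹ * (S α k ξ)⁻¹) * (ξ ^ 0 * ((ξ ^ 2 + α ^ 2) ^ k)⁻¹) := by
  funext ξ
  simp only [Lhat, pow_zero]
  ring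

lemma contDiff_const_mul_inv_S {α : ℝ} (hα : 0 < α) {k : ℕ} (hk : 1 ≤ k) (n : WithTop ℕ∞) :
    ContDiff ℝ n fun ξ => (Real.sqrt (2 * Real.pi))⁻¹ * (S α k ξ)⁻¹ :=
  contDiff_const.mul ((contDiff_S hα hk n).inv fun ξ => (S_pos hα hk ξ).ne')

lemma contDiff_Lhat {α : ℝ} (hα : 0 < α) {k : ℕ} (hk : 1 ≤ k) (n : WithTop ℕ∞) :
    ContDiff ℝ n (Lhat α k) := by
  rw [Lhat_eq]
  exact (contDiff_const_mul_inv_S hα hk n).mul (contDiff_pow_mul_inv_pow hα 0 k n)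

lemma integrable_iteratedDeriv_Lhat {α : ℝ} (hα : 0 < α) {k : ℕ} (hk : 1 ≤ k) (n : ℕ) :
    Integrable (iteratedDeriv n (Lhat α k)) := by
  have hP := contDiff_const_mul_inv_S hα hk
  have hg := contDiff_pow_mul_inv_pow hα 0 k
  have hper : Function.Periodic
      (fun ξ => (Real.sqrt (2 * Real.pi))⁻¹ * (S α k ξ)⁻¹) (2 * Real.pi) := fun ξ => by
    simp only [S_periodic α k ξ]
  rw [Lhat_eq]
  refine Integrable.congr ?_ (ae_of_all _ fun ξ =>
    (iteratedDeriv_fun_mul (n := n) (x := ξ) (hP n).contDiffAt (hg n).contDiffAt).symm)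
  refine integrable_finsetSum _ fun i _ => ?_
  obtain ⟨M, hM⟩ := hper.exists_norm_iteratedDeriv_le (by positivity) i (hP i)
  simp only [mul_assoc]
  refine Integrable.const_mul ?_ _
  exact (integrable_iteratedDeriv_pow_mul_inv_pow hα (n - i) (by omega)).bdd_mul
    ((hP i).continuous_iteratedDeriv i le_rfl).aestronglyMeasurable (ae_of_all _ hM)

lemma iteratedDeriv_ofReal_comp (n : ℕ) : ∀ {f : ℝ → ℝ}, ContDiff ℝ n f →
    (iteratedDeriv n fun x => (f x : ℂ)) = fun x => ((iteratedDeriv n f x : ℝ) : ℂ) := by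
  induction n with
  | zero => intro f _; simp
  | succ n ih =>
    intro f hf
    have hd : Differentiable ℝ f := hf.differentiable (by simp)
    have hderiv : (deriv fun x => (f x : ℂ)) = fun x => ((deriv f x : ℝ) : ℂ) :=
      funext fun x => (hd x).hasDerivAt.ofReal_comp.deriv
    rw [iteratedDeriv_succ', hderiv, iteratedDeriv_succ']
    exact ih (contDiff_succ_iff_deriv.mp (by exact_mod_cast hf)).2.2

open FourierTransform in
lemma Lk_eq_re_fourier (α : ℝ) (k : ℕ) (x : ℝ) :
    Lk α k x = (((Real.sqrt (2 * Real.pi) : ℂ))⁻¹ *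
      𝓕 (fun ξ => (Lhat α k ξ : ℂ)) (-x / (2 * Real.pi))).re := by
  rw [Lk, Real.fourier_real_eq_integral_exp_smul]
  congr 3
  funext ξ
  rw [smul_eq_mul, mul_comm]
  congr 2
  have : (Real.pi : ℂ) ≠ 0 := by exact_mod_cast Real.pi_ne_zero
  push_cast
  field_simp

open FourierTransform in
lemma exists_abs_pow_mul_abs_Lk_le {α : ℝ} (hα : 0 < α) {k : ℕ} (hk : 1 ≤ k) (n : ℕ) :
    ∃ D : ℝ, ∀ x : ℝ, |x| ^ n * |Lk α k x| ≤ D := by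
  set f : ℝ → ℂ := fun ξ => (Lhat α k ξ : ℂ)
  have hf : ContDiff ℝ (n : ℕ∞) f :=
    Complex.ofRealCLM.contDiff.comp (contDiff_Lhat hα hk _)
  have hint : ∀ m : ℕ, (m : ℕ∞) ≤ n → Integrable (iteratedDeriv m f) := fun m _ => by
    rw [iteratedDeriv_ofReal_comp m (contDiff_Lhat hα hk m)]
    exact (integrable_iteratedDeriv_Lhat hα hk m).ofReal
  refine ⟨‖((Real.sqrt (2 * Real.pi) : ℂ))⁻¹‖ * ∫ ξ, ‖iteratedDeriv n f ξ‖, fun x => ?_⟩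
  have hF := congrFun (Real.fourier_iteratedDeriv hf hint le_rfl) (-x / (2 * Real.pi))
  have hle : ‖𝓕 (iteratedDeriv n f) (-x / (2 * Real.pi))‖ ≤ ∫ ξ, ‖iteratedDeriv n f ξ‖ :=
    VectorFourier.norm_fourierIntegral_le_integral_norm _ _ _ _ _
  have hx : ‖2 * Real.pi * Complex.I * ((-x / (2 * Real.pi) : ℝ) : ℂ)‖ = |x| := by
    have : (Real.pi : ℂ) ≠ 0 := by exact_mod_cast Real.pi_ne_zero
    have h : 2 * Real.pi * Complex.I * ((-x / (2 * Real.pi) : ℝ) : ℂ) = -(Complex.I * x) := by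
      push_cast
      field_simp
    rw [h]
    simp
  rw [hF, norm_smul, norm_pow, hx] at hle
  rw [Lk_eq_re_fourier]
  calc |x| ^ n * |(((Real.sqrt (2 * Real.pi) : ℂ))⁻¹ * 𝓕 f (-x / (2 * Real.pi))).re|
      ≤ |x| ^ n * ‖((Real.sqrt (2 * Real.pi) : ℂ))⁻¹ * 𝓕 f (-x / (2 * Real.pi))‖ := by
        gcongr
        exact Complex.abs_re_le_norm _
    _ = ‖((Real.sqrt (2 * Real.pi) : ℂ))⁻¹‖ * (|x| ^ n * ‖𝓕 f (-x / (2 * Real.pi))‖) := by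
        rw [norm_mul]; ring
    _ ≤ _ := by gcongr

/-- The fundamental function decays faster than any power. -/
lemma exists_abs_Lk_le {α : ℝ} (hα : 0 < α) {k : ℕ} (hk : 1 ≤ k) (n : ℕ) :
    ∃ D > 0, ∀ x : ℝ, |Lk α k x| ≤ D * ((1 + |x|) ^ n)⁻¹ := by
  obtain ⟨D₀, h₀⟩ := exists_abs_pow_mul_abs_Lk_le hα hk 0
  obtain ⟨D₁, h₁⟩ := exists_abs_pow_mul_abs_Lk_le hα hk n
  have hD₀ : 0 ≤ D₀ := le_trans (by positivity) (h₀ 0)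
  have hD₁ : 0 ≤ D₁ := le_trans (by positivity) (h₁ 0)
  refine ⟨2 ^ (n - 1) * (D₀ + D₁) + 1, by positivity, fun x => ?_⟩
  rw [← div_eq_mul_inv, le_div_iff₀ (by positivity)]
  have hpow : (1 + |x|) ^ n ≤ 2 ^ (n - 1) * (1 ^ n + |x| ^ n) :=
    add_pow_le zero_le_one (abs_nonneg x) n
  calc |Lk α k x| * (1 + |x|) ^ n ≤ |Lk α k x| * (2 ^ (n - 1) * (1 ^ n + |x| ^ n)) := by gcongr
    _ = 2 ^ (n - 1) * (|x| ^ 0 * |Lk α k x| + |x| ^ n * |Lk α k x|) := by ring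
    _ ≤ 2 ^ (n - 1) * (D₀ + D₁) := by
        gcongr
        exacts [h₀ x, h₁ x]
    _ ≤ _ := by linarith

lemma inv_one_add_abs_sub_sq_le (x : ℝ) (i : ℤ) :
    ((1 + |x - (⌊x⌋ + i : ℤ)|) ^ 2)⁻¹ ≤ 4 * (1 + (i : ℝ) ^ 2)⁻¹ := by
  have h0 := Int.fract_nonneg x
  have h1 := Int.fract_lt_one x
  have hx : x - (⌊x⌋ + i : ℤ) = Int.fract x - i := by
    push_cast
    rw [Int.fract]
    ring
  rw [hx, ← div_eq_mul_inv, le_div_iff₀ (by positivity), inv_mul_le_iff₀ (by positivity)]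
  have hi : |(i : ℝ)| ≤ |Int.fract x - i| + 1 := by
    rw [abs_le]
    constructor <;> cases abs_cases (Int.fract x - (i : ℝ)) <;> linarith
  have hsq : (i : ℝ) ^ 2 ≤ (|Int.fract x - i| + 1) ^ 2 := by
    rw [← sq_abs]
    gcongr
  nlinarith [abs_nonneg (Int.fract x - (i : ℝ))]

lemma one_add_abs_rpow_le {β : ℝ} (hβ : 0 ≤ β) (x y : ℝ) :
    (1 + |y|) ^ β ≤ (1 + |x|) ^ β * (1 + |x - y|) ^ β := by
  rw [← Real.mul_rpow (by positivity) (by positivity)]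
  refine Real.rpow_le_rpow (by positivity) ?_ hβ
  have : |y| ≤ |x| + |x - y| := by
    have h := abs_sub_abs_le_abs_sub y x
    rw [abs_sub_comm] at h
    linarith
  nlinarith [mul_nonneg (abs_nonneg x) (abs_nonneg (x - y))]

/-- The interpolant of a sequence of polynomial growth of order β
has polynomial growth of order β. -/
theorem stmt_9 (α : ℝ) (hα : 0 < α) (k : ℕ) (hk : 1 ≤ k) (b : ℤ → ℝ)
    (C₀ β : ℝ) (hC₀ : 0 < C₀) (hβ : 0 < β)
    (hb : ∀ j : ℤ, |b j| ≤ C₀ * (1 + |(j : ℝ)|) ^ β) :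
    ∃ C > (0 : ℝ), ∀ x : ℝ,
      |∑' j : ℤ, b j * Lk α k (x - j)| ≤ C * (1 + |x|) ^ β := by
  obtain ⟨D, hD, hL⟩ := exists_abs_Lk_le hα hk (⌈β⌉₊ + 2)
  set T : ℝ := ∑' i : ℤ, (1 + (i : ℝ) ^ 2)⁻¹ with hT
  have hT0 : 0 < T :=
    summable_int_inv_one_add_sq.tsum_pos (fun i => by positivity) 0 (by positivity)
  refine ⟨C₀ * D * 4 * T, by positivity, fun x => ?_⟩
  have hterm : ∀ j : ℤ, |b j * Lk α k (x - j)| ≤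
      C₀ * D * (1 + |x|) ^ β * ((1 + |x - j|) ^ 2)⁻¹ := fun j => by
    set y : ℝ := x - j with hy
    have hone : 1 ≤ 1 + |y| := by linarith [abs_nonneg y]
    have hpow : (1 + |y|) ^ β ≤ (1 + |y|) ^ ⌈β⌉₊ := by
      rw [← Real.rpow_natCast]
      exact Real.rpow_le_rpow_of_exponent_le hone (Nat.le_ceil β)
    calc |b j * Lk α k y| = |b j| * |Lk α k y| := abs_mul _ _
      _ ≤ (C₀ * ((1 + |x|) ^ β * (1 + |y|) ^ ⌈β⌉₊)) * (D * ((1 + |y|) ^ (⌈β⌉₊ + 2))⁻¹) := by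
          refine mul_le_mul ((hb j).trans ?_) (hL y) (abs_nonneg _) (by positivity)
          gcongr
          refine (one_add_abs_rpow_le hβ.le x j).trans ?_
          gcongr
      _ = _ := by
          rw [pow_add]
          field_simp
  rw [← (Equiv.addLeft ⌊x⌋).tsum_eq, ← Real.norm_eq_abs]
  refine (tsum_of_norm_bounded
    (summable_int_inv_one_add_sq.hasSum.mul_left (C₀ * D * (1 + |x|) ^ β * 4)) fun i => ?_).trans
    (le_of_eq (by rw [← hT]; ring))
  rw [Real.norm_eq_abs, Equiv.coe_addLeft, mul_assoc _ (4 : ℝ)]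
  refine (hterm _).trans ?_
  gcongr
  exact inv_one_add_abs_sub_sq_le x i
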